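/- Let i be a nonnegative integer and let α, β be complex numbers. Assume that (β)_{m+n} and (α/2)_n are nonzero for all nonnegative integers m, n, that no argument of Γ appearing on the right-hand side below is a nonpositive integer, and that the double series defining the Kampé de Fériet function converges absolutely. Then F^{1:1;2}_{1:0;1}[α : β−2+i ; 2−i, α/2+1 ; β : — ; α/2 ; −1, −1] = (2^{−2−α} · Γ(β/2)) / Γ(β/2+i−2) · Σ_{r=0}^{i} C(i,r) · Γ(β/4−1+(r+i)/2) / Γ(β/4+1+(r−i)/2). -/

import Mathlib

open Complex

noncomputable section

/-- Pochhammer symbol `(a)_n = a (a+1) ⋯ (a+n-1)`. -/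
def poch (a : ℂ) (n : ℕ) : ℂ := ∏ k ∈ Finset.range n, (a + k)

/-- `z` is not a nonpositive integer. -/
def notNonposInt (z : ℂ) : Prop := ∀ n : ℕ, z ≠ -(n : ℂ)

/-- Term of the Kampé de Fériet double series `F^{1:1;2}_{1:0;1}`. -/
def kdfTerm (α ε b₁ b₂ β d₁ x y : ℂ) (p : ℕ × ℕ) : ℂ :=
  poch α (p.1 + p.2) * poch ε p.1 * poch b₁ p.2 * poch b₂ p.2 /
    (poch β (p.1 + p.2) * poch d₁ p.2) * x ^ p.1 * y ^ p.2 /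
    ((p.1.factorial : ℂ) * (p.2.factorial : ℂ))

theorem poch_succ (a : ℂ) (n : ℕ) : poch a (n + 1) = poch a n * (a + n) :=
  Finset.prod_range_succ _ _

theorem poch_succ' (a : ℂ) (n : ℕ) : poch a (n + 1) = a * poch (a + 1) n := by
  rw [poch, Finset.prod_range_succ', mul_comm, poch]
  simp only [Nat.cast_zero, add_zero]
  congr 1
  refine Finset.prod_congr rfl fun k _ => ?_
  push_cast
  ring

theorem mul_poch_add_one (a : ℂ) (n : ℕ) : a * poch (a + 1) n = poch a n * (a + n) := by
  rw [← poch_succ', poch_succ]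

/-- Coefficients `(a)_n / n!` of the binomial series `(1 - x) ^ (-a)`. -/
def pochCoeff (a : ℂ) (n : ℕ) : ℂ := poch a n / (n.factorial : ℂ)

theorem poch_eq_descPochhammer (a : ℂ) (n : ℕ) :
    poch a n = (-1) ^ n * (descPochhammer ℤ n).smeval (-a) := by
  induction n with
  | zero => simp [poch]
  | succ n ih =>
    rw [poch_succ, ih, descPochhammer_succ_right, Polynomial.smeval_mul, Polynomial.smeval_sub,
      Polynomial.smeval_X, Polynomial.smeval_natCast]
    simp only [pow_one, pow_zero, nsmul_eq_mul, mul_one]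
    ring

theorem pochCoeff_eq_choose (a : ℂ) (n : ℕ) :
    pochCoeff a n = (-1) ^ n * Ring.choose (-a) n := by
  rw [pochCoeff, poch_eq_descPochhammer, Ring.choose_eq_smul, smul_eq_mul]
  ring

theorem sum_antidiagonal_pochCoeff (a b : ℂ) (N : ℕ) :
    ∑ p ∈ Finset.HasAntidiagonal.antidiagonal N, pochCoeff a p.1 * pochCoeff b p.2 = pochCoeff (a + b) N := by
  rw [pochCoeff_eq_choose, neg_add, Ring.add_choose_eq N (Commute.all _ _), Finset.mul_sum]
  refine Finset.sum_congr rfl fun p hp => ?_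
  rw [Finset.HasAntidiagonal.mem_antidiagonal] at hp
  rw [pochCoeff_eq_choose, pochCoeff_eq_choose, ← hp, pow_add]
  ring

theorem succ_mul_pochCoeff_succ (a : ℂ) (n : ℕ) :
    ((n : ℂ) + 1) * pochCoeff a (n + 1) = a * pochCoeff (a + 1) n := by
  have h1 : (n.factorial : ℂ) ≠ 0 := by exact_mod_cast n.factorial_ne_zero
  have h2 : (n : ℂ) + 1 ≠ 0 := n.cast_add_one_ne_zero
  rw [pochCoeff, pochCoeff, poch_succ', Nat.factorial_succ]
  push_cast
  field_simp

theorem sum_antidiagonal_pochCoeff_mul_cast (a b : ℂ) (hab : a + b ≠ 0) (N : ℕ) :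
    ∑ p ∈ Finset.HasAntidiagonal.antidiagonal N, pochCoeff a p.1 * pochCoeff b p.2 * (p.2 : ℂ) =
      b / (a + b) * (N * pochCoeff (a + b) N) := by
  cases N with
  | zero => simp
  | succ M =>
    rw [Finset.Nat.sum_antidiagonal_succ']
    have h : ∀ p : ℕ × ℕ, pochCoeff a p.1 * pochCoeff b (p.2 + 1) * ((p.2 + 1 : ℕ) : ℂ) =
        b * (pochCoeff a p.1 * pochCoeff (b + 1) p.2) := fun p => by
      have := succ_mul_pochCoeff_succ b p.2
      push_cast
      linear_combination pochCoeff a p.1 * this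
    simp only [h]
    rw [← Finset.mul_sum, sum_antidiagonal_pochCoeff]
    push_cast
    rw [succ_mul_pochCoeff_succ, add_assoc]
    field_simp
    simp

theorem hasSum_pochCoeff (a : ℂ) {x : ℂ} (hx : ‖x‖ < 1) :
    HasSum (fun n : ℕ => (-1) ^ n * pochCoeff a n * x ^ n) ((1 + x) ^ (-a)) := by
  have hx' : x ∈ Metric.eball (0 : ℂ) 1 := by
    rw [← ENNReal.ofReal_one, Metric.eball_ofReal]
    simpa using hx
  have h := (one_add_cpow_hasFPowerSeriesOnBall_zero (a := -a)).hasSum hx'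
  rw [zero_add] at h
  refine h.congr_fun ?_
  intro n
  simp only [binomialSeries_apply, List.ofFn_const, List.prod_replicate, smul_eq_mul,
    pochCoeff_eq_choose, ← mul_assoc, ← mul_pow]
  norm_num

theorem hasSum_cast_mul_pochCoeff (a : ℂ) {x : ℂ} (hx : ‖x‖ < 1) :
    HasSum (fun n : ℕ => (-1) ^ n * ((n : ℂ) * pochCoeff a n) * x ^ n)
      (-(a * x) * (1 + x) ^ (-(a + 1))) := by
  have h := (hasSum_pochCoeff (a + 1) hx).mul_left (-(a * x))
  rw [← hasSum_nat_add_iff' 1]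
  simp only [Finset.range_one, Finset.sum_singleton, Nat.cast_zero, zero_mul, mul_zero, sub_zero]
  refine h.congr_fun fun n => ?_
  push_cast
  rw [succ_mul_pochCoeff_succ]
  ring

theorem tsum_pochCoeff_affine (a t : ℂ)
    (h : Summable fun n : ℕ => (-1) ^ n * pochCoeff a n * (1 + t * n)) :
    ∑' n : ℕ, (-1) ^ n * pochCoeff a n * (1 + t * n) = (2 : ℂ) ^ (-a) * (1 - t * a / 2) := by
  have hlim := tendsto_tsum_powerSeries_nhdsWithin_lt h.hasSum.tendsto_sum_nat
  rw [Filter.tendsto_map'_iff] at hlim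
  have hev : ∀ᶠ x : ℝ in nhdsWithin 1 (Set.Iio 1),
      (1 + (x : ℂ)) ^ (-a) + t * (-(a * x) * (1 + (x : ℂ)) ^ (-(a + 1))) =
        ((fun z : ℂ => ∑' n : ℕ, (-1) ^ n * pochCoeff a n * (1 + t * n) * z ^ n) ∘ ofReal) x := by
    filter_upwards [Ioo_mem_nhdsLT (zero_lt_one (α := ℝ))] with x hx
    have hx' : ‖(x : ℂ)‖ < 1 := by
      rw [norm_real, Real.norm_eq_abs, abs_of_pos hx.1]
      exact hx.2
    refine (((hasSum_pochCoeff a hx').add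
      ((hasSum_cast_mul_pochCoeff a hx').mul_left t)).congr_fun fun n => ?_).tsum_eq.symm
    ring
  have hc : ContinuousAt (fun x : ℝ =>
      (1 + (x : ℂ)) ^ (-a) + t * (-(a * x) * (1 + (x : ℂ)) ^ (-(a + 1)))) 1 := by
    have h1 : (1 + ((1 : ℝ) : ℂ)) ∈ slitPlane := by
      left
      norm_num
    have h2 : ContinuousAt (fun x : ℝ => 1 + (x : ℂ)) 1 := by fun_prop
    exact (h2.cpow continuousAt_const h1).add (continuousAt_const.mul
      ((by fun_prop : ContinuousAt (fun x : ℝ => -(a * (x : ℂ))) 1).mul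
        (h2.cpow continuousAt_const h1)))
  have hu := tendsto_nhds_unique hlim
    ((hc.tendsto.mono_left nhdsWithin_le_nhds).congr' hev)
  rw [hu, ofReal_one, show (1 + 1 : ℂ) = 2 by norm_num, neg_add, cpow_add _ _ two_ne_zero,
    cpow_neg_one]
  ring

theorem kdfTerm_eq (α ε b β : ℂ) (hα : α ≠ 0) (hd : ∀ n : ℕ, poch (α / 2) n ≠ 0) (p : ℕ × ℕ) :
    kdfTerm α ε b (α / 2 + 1) β (α / 2) (-1) (-1) p =
      (-1) ^ (p.1 + p.2) * poch α (p.1 + p.2) / poch β (p.1 + p.2) *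
        (pochCoeff ε p.1 * pochCoeff b p.2 + 2 / α * (pochCoeff ε p.1 * pochCoeff b p.2 * p.2)) := by
  have h : poch (α / 2 + 1) p.2 / poch (α / 2) p.2 = 1 + 2 / α * p.2 := by
    have := mul_poch_add_one (α / 2) p.2
    have h0 := hd p.2
    rw [div_eq_iff h0, ← mul_right_inj' (div_ne_zero hα two_ne_zero), this]
    field_simp
  calc kdfTerm α ε b (α / 2 + 1) β (α / 2) (-1) (-1) p
      = (-1) ^ (p.1 + p.2) * poch α (p.1 + p.2) / poch β (p.1 + p.2) *
        (pochCoeff ε p.1 * pochCoeff b p.2) * (poch (α / 2 + 1) p.2 / poch (α / 2) p.2) := by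
        simp only [kdfTerm, pochCoeff, pow_add, div_eq_mul_inv, mul_inv]
        ring
    _ = _ := by
        rw [h]
        ring

theorem tsum_kdfTerm (α ε b β : ℂ) (hεb : ε + b = β) (hβ : ∀ n : ℕ, poch β n ≠ 0)
    (hd : ∀ n : ℕ, poch (α / 2) n ≠ 0)
    (hsum : Summable (kdfTerm α ε b (α / 2 + 1) β (α / 2) (-1) (-1))) :
    ∑' p : ℕ × ℕ, kdfTerm α ε b (α / 2 + 1) β (α / 2) (-1) (-1) p =
      (2 : ℂ) ^ (-α) * (1 - b / β) := by
  have hα : α ≠ 0 := by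
    have := hd 1
    simpa [poch] using this
  have hβ0 : β ≠ 0 := by
    have := hβ 1
    simpa [poch] using this
  have hinner : ∀ N : ℕ, ∑' q : Finset.HasAntidiagonal.antidiagonal N,
      kdfTerm α ε b (α / 2 + 1) β (α / 2) (-1) (-1) (q : ℕ × ℕ) =
      (-1) ^ N * pochCoeff α N * (1 + 2 * b / (α * β) * N) := fun N => by
    rw [Finset.tsum_subtype (Finset.HasAntidiagonal.antidiagonal N)
      (kdfTerm α ε b (α / 2 + 1) β (α / 2) (-1) (-1))]
    have h1 : ∀ p ∈ Finset.HasAntidiagonal.antidiagonal N, kdfTerm α ε b (α / 2 + 1) β (α / 2) (-1) (-1) p =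
        (-1) ^ N * poch α N / poch β N * (pochCoeff ε p.1 * pochCoeff b p.2 +
          2 / α * (pochCoeff ε p.1 * pochCoeff b p.2 * p.2)) := fun p hp => by
      rw [kdfTerm_eq α ε b β hα hd, Finset.HasAntidiagonal.mem_antidiagonal.1 hp]
    rw [Finset.sum_congr rfl h1, ← Finset.mul_sum, Finset.sum_add_distrib, ← Finset.mul_sum,
      sum_antidiagonal_pochCoeff, sum_antidiagonal_pochCoeff_mul_cast ε b (hεb ▸ hβ0), hεb]
    have h2 := hβ N
    simp only [pochCoeff]
    field_simp
  have hs := (Finset.HasAntidiagonal.sigmaAntidiagonalEquivProd (A := ℕ)).summable_iff.2 hsum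
  have hs' := hs.sigma
  rw [← (Finset.HasAntidiagonal.sigmaAntidiagonalEquivProd (A := ℕ)).tsum_eq]
  refine hs.tsum_sigma.trans ?_
  simp only [Function.comp_apply, Finset.HasAntidiagonal.sigmaAntidiagonalEquivProd_apply, hinner]
    at hs' ⊢
  rw [tsum_pochCoeff_affine _ _ hs']
  congr 2
  field_simp

theorem succ_mul_choose_eq (n r : ℕ) :
    (r : ℂ) * ((n + 1).choose r : ℂ) = (n + 1) * (((n + 1).choose r : ℂ) - (n.choose r : ℂ)) := by
  cases r with
  | zero => simp
  | succ r =>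
    have h1 : ((n + 1 : ℕ) : ℂ) * (n.choose r : ℂ) = ((n + 1).choose (r + 1) : ℂ) * ((r + 1 : ℕ) : ℂ) := by
      exact_mod_cast Nat.add_one_mul_choose_eq n r
    have h2 : ((n + 1).choose (r + 1) : ℂ) = n.choose r + n.choose (r + 1) := by
      exact_mod_cast Nat.choose_succ_succ n r
    push_cast at h1 ⊢
    linear_combination (norm := ring_nf) -h1 - (n + 1 : ℂ) * h2

theorem sum_choose_succ_mul (n : ℕ) (f : ℕ → ℂ) :
    ∑ r ∈ Finset.range (n + 2), ((n + 1).choose r : ℂ) * f r =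
      ∑ r ∈ Finset.range (n + 1), (n.choose r : ℂ) * f r +
        ∑ r ∈ Finset.range (n + 1), (n.choose r : ℂ) * f (r + 1) := by
  have h : ∑ r ∈ Finset.range (n + 1), (n.choose r : ℂ) * f r =
      ∑ r ∈ Finset.range (n + 2), (n.choose r : ℂ) * f r := by
    rw [Finset.sum_range_succ _ (n + 1), Nat.choose_succ_self]
    simp
  rw [h, Finset.sum_range_succ', Finset.sum_range_succ' (fun r => (n.choose r : ℂ) * f r)]
  simp only [Nat.choose_succ_succ, Nat.cast_add, add_mul, Finset.sum_add_distrib,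
    Nat.choose_zero_right]
  ring

theorem sum_choose_add_two_mul_poch_of_sum_choose_mul_poch {k : ℕ}
    (h : ∀ z : ℂ, ∑ r ∈ Finset.range (k + 2), ((k + 1).choose r : ℂ) * poch (z + r / 2) k =
      2 * poch (2 * z + k) k) (z : ℂ) :
    ∑ r ∈ Finset.range (k + 3), ((k + 2).choose r : ℂ) * poch (z + r / 2) k =
      2 * poch (2 * z + k) k + 2 * poch (2 * z + k + 1) k := by
  rw [sum_choose_succ_mul (k + 1), h z]
  have := h (z + 1 / 2)
  rw [show 2 * (z + 1 / 2) + (k : ℂ) = 2 * z + k + 1 by ring] at this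
  rw [← this]
  congr 1
  refine Finset.sum_congr rfl fun r _ => ?_
  push_cast
  ring_nf

theorem sum_choose_mul_poch (k : ℕ) (z : ℂ) :
    ∑ r ∈ Finset.range (k + 2), ((k + 1).choose r : ℂ) * poch (z + r / 2) k =
      2 * poch (2 * z + k) k := by
  induction k generalizing z with
  | zero => norm_num [Finset.sum_range_succ, poch]
  | succ k ih =>
    have hext : ∑ r ∈ Finset.range (k + 3), ((k + 1).choose r : ℂ) * poch (z + r / 2) k =
        2 * poch (2 * z + k) k := by
      rw [Finset.sum_range_succ _ (k + 2), ih z, Nat.choose_succ_self]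
      simp
    have hterm : ∀ r : ℕ, ((k + 2).choose r : ℂ) * poch (z + r / 2) (k + 1) =
        (z + k + (k + 2) / 2) * (((k + 2).choose r : ℂ) * poch (z + r / 2) k) -
          (k + 2) / 2 * (((k + 1).choose r : ℂ) * poch (z + r / 2) k) := fun r => by
      have := succ_mul_choose_eq (k + 1) r
      push_cast at this
      rw [poch_succ]
      linear_combination poch (z + r / 2) k / 2 * this
    rw [Finset.sum_congr rfl fun r _ => hterm r, Finset.sum_sub_distrib, ← Finset.mul_sum,
      ← Finset.mul_sum, sum_choose_add_two_mul_poch_of_sum_choose_mul_poch ih, hext]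
    have h := mul_poch_add_one (2 * z + k) k
    push_cast
    rw [poch_succ, ← add_assoc]
    linear_combination -h

theorem sum_choose_add_two_mul_poch (k : ℕ) (z : ℂ) :
    ∑ r ∈ Finset.range (k + 3), ((k + 2).choose r : ℂ) * poch (z + r / 2) k =
      2 * poch (2 * z + k) k + 2 * poch (2 * z + k + 1) k :=
  sum_choose_add_two_mul_poch_of_sum_choose_mul_poch (sum_choose_mul_poch k) z

theorem Gamma_add_natCast (z : ℂ) (hz : notNonposInt z) (n : ℕ) :
    Gamma (z + n) = poch z n * Gamma z := by
  induction n with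
  | zero => simp [poch]
  | succ n ih =>
    have h : z + n ≠ 0 := fun h => hz n (eq_neg_of_add_eq_zero_left h)
    rw [Nat.cast_succ, ← add_assoc, Gamma_add_one _ h, ih, poch_succ]
    ring

theorem Gamma_sum_eq (i : ℕ) (β : ℂ) (hβ0 : β ≠ 0)
    (hΓ1 : notNonposInt (β / 2))
    (hΓ2 : notNonposInt (β / 2 + (i : ℂ) - 2))
    (hΓs : ∀ r : ℕ, r ≤ i →
      notNonposInt (β / 4 - 1 + ((r : ℂ) + (i : ℂ)) / 2) ∧
        notNonposInt (β / 4 + 1 + ((r : ℂ) - (i : ℂ)) / 2)) :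
    Gamma (β / 2) / Gamma (β / 2 + (i : ℂ) - 2) *
      ∑ r ∈ Finset.range (i + 1), (i.choose r : ℂ) *
        Gamma (β / 4 - 1 + ((r : ℂ) + (i : ℂ)) / 2) /
        Gamma (β / 4 + 1 + ((r : ℂ) - (i : ℂ)) / 2) = 4 * (1 - (2 - (i : ℂ)) / β) := by
  have hne : Gamma (β / 2 + (i : ℂ) - 2) ≠ 0 := Gamma_ne_zero hΓ2
  match i with
  | 0 =>
    have hs := (hΓs 0 le_rfl).1
    have hs0 := Gamma_ne_zero hs
    simp only [Nat.cast_zero, add_zero, zero_div, sub_zero] at *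
    have e1 := Gamma_add_natCast _ hΓ2 2
    have e2 := Gamma_add_natCast _ hs 2
    have n1 := hs 0
    simp only [Nat.cast_zero, neg_zero] at n1
    have n2 : β - 4 ≠ 0 := fun h => n1 (by linear_combination h / 4)
    norm_num [poch, Finset.prod_range_succ] at e1 e2 ⊢
    rw [show β / 4 + 1 = β / 4 - 1 + 2 by ring, e2, e1]
    generalize Gamma (β / 2 - 2) = G at hne ⊢
    generalize Gamma (β / 4 - 1) = H at hs0 ⊢
    rw [show β / 4 - 1 = (β - 4) / 4 by ring]
    field_simp
    ring
  | 1 =>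
    have hs := (hΓs 0 zero_le_one).1
    have hs0 := Gamma_ne_zero hs
    have hs' := (hΓs 1 le_rfl).1
    have hs0' := Gamma_ne_zero hs'
    have e1 := Gamma_add_natCast _ hΓ2 1
    have e2 := Gamma_add_natCast _ hs 1
    have e3 := Gamma_add_natCast _ hs' 1
    have n1 := hs 0
    simp only [Nat.cast_zero, neg_zero] at n1
    have n2 : β - 2 ≠ 0 := fun h => n1 (by push_cast; linear_combination h / 4)
    simp only [Finset.sum_range_succ, Finset.sum_range_zero, poch, Finset.prod_range_one,
      Nat.cast_zero, Nat.cast_one, Nat.choose_zero_right, Nat.choose_self] at *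
    rw [show β / 2 = β / 2 + 1 - 2 + 1 by ring, e1,
      show β / 4 + 1 + ((0 : ℂ) - 1) / 2 = β / 4 - 1 + (0 + 1) / 2 + 1 by ring, e2,
      show β / 4 + 1 + ((1 : ℂ) - 1) / 2 = β / 4 - 1 + (1 + 1) / 2 + 1 by ring, e3,
      show β / 2 + 1 - 2 + 1 + 1 - 2 = β / 2 + 1 - 2 by ring]
    have m1 : β / 4 - 1 + (0 + 1) / 2 + 0 = (β - 2) / 4 := by ring
    have m2 : β / 4 - 1 + (1 + 1) / 2 + 0 = β / 4 := by ring
    have m3 : β / 2 + 1 - 2 + 0 = (β - 2) / 2 := by ring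
    rw [m1, m2, m3]
    generalize Gamma (β / 2 + 1 - 2) = G at hne ⊢
    generalize Gamma (β / 4 - 1 + (0 + 1) / 2) = H at hs0 ⊢
    generalize Gamma (β / 4 - 1 + (1 + 1) / 2) = K at hs0' ⊢
    field_simp
    ring
  | k + 2 =>
    have hterm : ∀ r ∈ Finset.range (k + 3), ((k + 2).choose r : ℂ) *
        Gamma (β / 4 - 1 + ((r : ℂ) + ((k + 2 : ℕ) : ℂ)) / 2) /
        Gamma (β / 4 + 1 + ((r : ℂ) - ((k + 2 : ℕ) : ℂ)) / 2) =
        ((k + 2).choose r : ℂ) * poch (β / 4 - k / 2 + r / 2) k := fun r hr => by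
      have h := (hΓs r (Nat.lt_succ_iff.1 (Finset.mem_range.1 hr))).2
      have h0 := Gamma_ne_zero h
      have e := Gamma_add_natCast _ h k
      rw [show β / 4 + 1 + ((r : ℂ) - ((k + 2 : ℕ) : ℂ)) / 2 + k =
        β / 4 - 1 + ((r : ℂ) + ((k + 2 : ℕ) : ℂ)) / 2 by push_cast; ring] at e
      rw [e, mul_div_assoc, mul_div_assoc, div_self h0, mul_one]
      congr 2
      push_cast
      ring
    have eΓ : Gamma (β / 2 + ((k + 2 : ℕ) : ℂ) - 2) = poch (β / 2) k * Gamma (β / 2) := by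
      rw [← Gamma_add_natCast _ hΓ1]
      congr 1
      push_cast
      ring
    have hΓ0 := Gamma_ne_zero hΓ1
    rw [eΓ] at hne
    have hp : poch (β / 2) k ≠ 0 := left_ne_zero_of_mul hne
    rw [Finset.sum_congr rfl hterm, sum_choose_add_two_mul_poch, eΓ]
    rw [show 2 * (β / 4 - k / 2) + (k : ℂ) = β / 2 by ring]
    have h := mul_poch_add_one (β / 2) k
    have h' : poch (β / 2 + 1) k = poch (β / 2) k * (β / 2 + k) / (β / 2) := by
      rw [← h]
      field_simp
    rw [h']
    push_cast
    field_simp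
    ring

theorem stmt_5 (i : ℕ) (α β : ℂ)
    (hβ : ∀ m n : ℕ, poch β (m + n) ≠ 0)
    (hd : ∀ n : ℕ, poch (α / 2) n ≠ 0)
    (hΓ1 : notNonposInt (β / 2))
    (hΓ2 : notNonposInt (β / 2 + (i : ℂ) - 2))
    (hΓs : ∀ r : ℕ, r ≤ i →
      notNonposInt (β / 4 - 1 + ((r : ℂ) + (i : ℂ)) / 2) ∧ notNonposInt (β / 4 + 1 + ((r : ℂ) - (i : ℂ)) / 2))
    (hsum : Summable fun p : ℕ × ℕ => ‖kdfTerm α (β - 2 + (i : ℂ)) (2 - (i : ℂ)) (α / 2 + 1) β (α / 2) (-1) (-1) p‖) :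
    (∑' p : ℕ × ℕ, kdfTerm α (β - 2 + (i : ℂ)) (2 - (i : ℂ)) (α / 2 + 1) β (α / 2) (-1) (-1) p) =
      (2 : ℂ) ^ (-2 - α) * Gamma (β / 2) / Gamma (β / 2 + (i : ℂ) - 2) *
      ∑ r ∈ Finset.range (i + 1), (i.choose r : ℂ) *
        Gamma (β / 4 - 1 + ((r : ℂ) + (i : ℂ)) / 2) /
        Gamma (β / 4 + 1 + ((r : ℂ) - (i : ℂ)) / 2) := by
  have hβ' : ∀ n : ℕ, poch β n ≠ 0 := fun n => by simpa using hβ 0 n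
  have hβ0 : β ≠ 0 := by simpa [poch] using hβ' 1
  rw [tsum_kdfTerm α (β - 2 + i) (2 - i) β (by ring) hβ' hd hsum.of_norm, mul_div_assoc,
    mul_assoc, Gamma_sum_eq i β hβ0 hΓ1 hΓ2 hΓs, sub_eq_add_neg (-2 : ℂ), cpow_add _ _ two_ne_zero]
  have h : (2 : ℂ) ^ (-2 : ℂ) = 1 / 4 := by
    rw [cpow_neg, show (2 : ℂ) = ((2 : ℕ) : ℂ) by norm_num, cpow_natCast]
    norm_num
  rw [h]
  ring
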